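/- arXiv:math/9401216 — 5 statements merged into one kernel-verified Lean document; each statement's English description precedes it below -/
import Mathlib

section
/- Let Ω be an infinite set and let 𝓑 be a countable algebra of subsets of Ω that contains all singletons {x} for x ∈ Ω. Let μ : 𝓑 → ℝ* be a nonnegative finitely additive hyperreal-valued measure such that μ(Ω) is infinite and μ({x}) is infinitesimal for every x ∈ Ω. Then there exists a set S ⊆ Ω such that: (1) for every D ∈ 𝓑 with μ(D) finite and every standard natural number n ≥ 1, there exists E ∈ 𝓑 with D ∩ S ⊆ E and μ(E) < 1/n; and (2) for every D ∈ 𝓑 with S ⊆ D, the measure μ(D) is infinite. -/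
set_option linter.deprecated false

theorem Hyperreal.not_infinite_of_nonneg_of_le {x y : Hyperreal} (hx : 0 ≤ x) (hxy : x ≤ y)
    (hy : ¬ y.Infinite) : ¬ x.Infinite := fun h ↦
  hy (Or.inl fun r ↦ ((Hyperreal.infinitePos_iff_infinite_of_nonneg hx).2 h r).trans_le hxy)

/-- Let `Ω` be an infinite set and `𝓑` a countable algebra of subsets of `Ω`
containing all singletons.  Let `μ : 𝓑 → ℝ*` be a nonnegative finitely additive hyperreal-valued
measure with `μ Ω` infinite and `μ {x}` infinitesimal for every `x`.  Then there is `S ⊆ Ω` such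
that (1) for every `D ∈ 𝓑` of finite measure and every standard `n ≥ 1` there is `E ∈ 𝓑` with
`D ∩ S ⊆ E` and `μ E < 1/n`, and (2) every `D ∈ 𝓑` containing `S` has infinite measure. -/
theorem infinite_loeb_outer_zero_inner
    (Ω : Type*) [Infinite Ω] (𝓑 : Set (Set Ω)) (hcount : 𝓑.Countable)
    (huniv : Set.univ ∈ 𝓑)
    (hinter : ∀ D ∈ 𝓑, ∀ E ∈ 𝓑, D ∩ E ∈ 𝓑)
    (hunion : ∀ D ∈ 𝓑, ∀ E ∈ 𝓑, D ∪ E ∈ 𝓑)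
    (hdiff : ∀ D ∈ 𝓑, ∀ E ∈ 𝓑, D \ E ∈ 𝓑)
    (hsing : ∀ x : Ω, {x} ∈ 𝓑)
    (μ : Set Ω → Hyperreal)
    (hnonneg : ∀ D ∈ 𝓑, 0 ≤ μ D)
    (hadd : ∀ D ∈ 𝓑, ∀ E ∈ 𝓑, Disjoint D E → μ (D ∪ E) = μ D + μ E)
    (hΩinf : (μ Set.univ).Infinite)
    (hsinginf : ∀ x : Ω, (μ {x}).Infinitesimal) :
    ∃ S : Set Ω,
      (∀ D ∈ 𝓑, ¬ (μ D).Infinite → ∀ n : ℕ, 1 ≤ n →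
        ∃ E ∈ 𝓑, D ∩ S ⊆ E ∧ μ E < 1 / (n : Hyperreal)) ∧
      (∀ D ∈ 𝓑, S ⊆ D → (μ D).Infinite) := by
  have hempty : ∅ ∈ 𝓑 := by simpa using hdiff _ huniv _ huniv
  have hμempty : μ ∅ = 0 := by simpa using hadd ∅ hempty ∅ hempty (by simp)
  have finite_union : ∀ D ∈ 𝓑, ∀ E ∈ 𝓑, ¬ (μ D).Infinite → ¬ (μ E).Infinite →
      ¬ (μ (D ∪ E)).Infinite := by
    intro D hD E hE hDf hEf
    have hED := hdiff E hE D hD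
    have h₁ : μ (D ∪ E) = μ D + μ (E \ D) := by
      rw [← hadd D hD _ hED Set.disjoint_sdiff_right, Set.union_sdiff_self]
    have h₂ : μ E = μ (E \ D) + μ (E ∩ D) := by
      rw [← hadd _ hED _ (hinter E hE D hD) Set.disjoint_sdiff_inter, Set.sdiff_union_inter]
    rw [h₁]
    refine Hyperreal.not_infinite_add hDf
      (Hyperreal.not_infinite_of_nonneg_of_le (hnonneg _ hED) ?_ hEf)
    rw [h₂]
    exact le_add_of_nonneg_right (hnonneg _ (hinter E hE D hD))
  have infinitesimal_of_finite : ∀ t : Set Ω, t.Finite → t ∈ 𝓑 ∧ (μ t).Infinitesimal := by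
    intro t ht
    induction t, ht using Set.Finite.induction_on with
    | empty => exact ⟨hempty, hμempty ▸ Hyperreal.infinitesimal_zero⟩
    | @insert a s ha _ ih =>
      rw [Set.insert_eq]
      refine ⟨hunion _ (hsing a) _ ih.1, ?_⟩
      rw [hadd _ (hsing a) _ ih.1 (Set.disjoint_singleton_left.2 ha)]
      exact (hsinginf a).add ih.2
  obtain ⟨D, hD⟩ : ∃ D : ℕ → Set Ω, {A | A ∈ 𝓑 ∧ ¬ (μ A).Infinite} = Set.range D :=
    (hcount.mono fun _ h ↦ h.1).exists_eq_range
      ⟨∅, hempty, hμempty ▸ Hyperreal.not_infinite_zero⟩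
  have hDmem : ∀ k, D k ∈ 𝓑 ∧ ¬ (μ (D k)).Infinite := fun k ↦ hD.ge (Set.mem_range_self k)
  have hacc : ∀ k, Set.accumulate D k ∈ 𝓑 ∧ ¬ (μ (Set.accumulate D k)).Infinite := by
    intro k
    induction k with
    | zero => simpa using hDmem 0
    | succ k ih =>
      rw [Set.accumulate_succ]
      exact ⟨hunion _ ih.1 _ (hDmem _).1, finite_union _ ih.1 _ (hDmem _).1 ih.2 (hDmem _).2⟩
  have hex : ∀ k, ∃ x, x ∉ Set.accumulate D k := fun k ↦
    (Set.ne_univ_iff_exists_notMem _).1 fun h ↦ (hacc k).2 (h ▸ hΩinf)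
  choose x hx using hex
  refine ⟨Set.range x, fun A hA hAf n hn ↦ ?_, fun A hA hS ↦ ?_⟩
  · obtain ⟨k, rfl⟩ := hD.le ⟨hA, hAf⟩
    have hfin : (D k ∩ Set.range x).Finite := by
      refine ((Set.finite_Iio k).image x).subset ?_
      rintro _ ⟨hm, m, rfl⟩
      refine ⟨m, Set.mem_Iio.2 (lt_of_not_ge fun hkm ↦ hx m ?_), rfl⟩
      exact Set.mem_accumulate.2 ⟨k, hkm, hm⟩
    obtain ⟨hmem, hinf⟩ := infinitesimal_of_finite _ hfin
    refine ⟨_, hmem, subset_rfl, ?_⟩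
    exact Hyperreal.lt_of_pos_of_infinitesimal hinf (1 / (n : ℝ)) (by positivity)
  · by_contra hAf
    obtain ⟨k, rfl⟩ := hD.le ⟨hA, hAf⟩
    exact hx k (Set.mem_accumulate.2 ⟨k, le_rfl, hS ⟨k, rfl⟩⟩)
end

section
/- Let P be a nonempty countable partial order in which every element has a strict upper bound, and let 𝒬 be a countable family of subsets of P. Then there exists a set S ⊆ P such that S ∉ 𝒬 and, for every p ∈ P, the set {s ∈ S : s < p} is finite. In particular, if 𝒬 contains every finite subset of P, then {s ∈ S : s < p} ∈ 𝒬 for every p ∈ P while S itself is not in 𝒬. -/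
/-- In a nonempty partial order without right endpoints, every finite set has an element outside
it that lies below none of its members. -/
theorem exists_forall_not_le_of_finset {P : Type*} [PartialOrder P] [Nonempty P]
    (hub : ∀ x : P, ∃ y : P, x < y) (F : Finset P) : ∃ x : P, ∀ f ∈ F, ¬ x ≤ f := by
  rcases F.eq_empty_or_nonempty with rfl | hF
  · exact ⟨Classical.arbitrary P, by simp⟩
  · obtain ⟨m, hm⟩ := F.exists_maximal hF
    obtain ⟨y, hy⟩ := hub m
    exact ⟨y, fun f hf hyf => hm.not_gt hf (hy.trans_le hyf)⟩

/-- A countable partial order without right endpoints has an infinite subset with finite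
initial segments. -/
theorem exists_infinite_set_with_finite_initial_segments (P : Type*) [PartialOrder P]
    [Nonempty P] [Countable P] (hub : ∀ x : P, ∃ y : P, x < y) :
    ∃ A : Set P, A.Infinite ∧ ∀ p : P, {s ∈ A | s < p}.Finite := by
  classical
  obtain ⟨e, he⟩ := exists_surjective_nat P
  choose s hs using fun n : ℕ =>
    exists_forall_not_le_of_finset hub ((Finset.range (n + 1)).image e)
  have hfin (p : P) : {n | s n ≤ p}.Finite := by
    obtain ⟨k, rfl⟩ := he p
    refine (Set.finite_Iio k).subset fun n hn => ?_
    by_contra hkn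
    exact hs n (e k) (Finset.mem_image_of_mem e (by grind)) hn
  refine ⟨Set.range s, fun hA => ?_, fun p => ?_⟩
  · refine Set.infinite_univ ((hA.biUnion fun p _ => hfin p).subset fun n _ => ?_)
    exact Set.mem_biUnion (Set.mem_range_self n) (le_refl (s n))
  · refine ((hfin p).image s).subset ?_
    rintro _ ⟨⟨n, rfl⟩, hn⟩
    exact ⟨n, hn.le, rfl⟩

/-- The powerset of an infinite set is uncountable. -/
theorem Set.Infinite.not_countable_powerset {α : Type*} {A : Set α} (hA : A.Infinite) :
    ¬ (𝒫 A).Countable := by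
  intro h
  have : Countable (Set A) := by
    have := h.to_subtype
    exact Function.Injective.countable
      (f := fun B : Set A => (⟨Subtype.val '' B, Subtype.coe_image_subset A B⟩ : 𝒫 A))
      fun B C hBC => Set.image_injective.2 Subtype.val_injective (congrArg Subtype.val hBC)
  obtain ⟨f, hf⟩ := exists_injective_nat (Set A)
  exact Function.cantor_injective _ ((hA.natEmbedding A).injective.comp hf)

/-- Let `P` be a nonempty countable partial order in which every element has a
strict upper bound, and let `𝒬` be a countable family of subsets of `P`.  Then there is `S ⊆ P`
with `S ∉ 𝒬` such that `{s ∈ S | s < p}` is finite for every `p ∈ P`.  In particular, if `𝒬`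
contains every finite subset of `P`, then `{s ∈ S | s < p} ∈ 𝒬` for every `p` while `S ∉ 𝒬`. -/
theorem exists_external_set_with_internal_initial_segments
    (P : Type*) [PartialOrder P] [Nonempty P] [Countable P]
    (hub : ∀ x : P, ∃ y : P, x < y)
    (𝒬 : Set (Set P)) (hcount : 𝒬.Countable) :
    ∃ S : Set P, S ∉ 𝒬 ∧ (∀ p : P, {s ∈ S | s < p}.Finite) ∧
      ((∀ F : Set P, F.Finite → F ∈ 𝒬) → ∀ p : P, {s ∈ S | s < p} ∈ 𝒬) := by
  obtain ⟨A, hA, hfin⟩ := exists_infinite_set_with_finite_initial_segments P hub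
  obtain ⟨S, hSA, hS⟩ : ∃ S ∈ 𝒫 A, S ∉ 𝒬 :=
    Set.not_subset.1 fun h => hA.not_countable_powerset (hcount.mono h)
  have hSfin (p : P) : {s ∈ S | s < p}.Finite :=
    (hfin p).subset fun s hs => ⟨hSA hs.1, hs.2⟩
  exact ⟨S, hS, hSfin, fun h p => h _ (hSfin p)⟩
end

section
/- Let P and Q be countably infinite sets and let F be a countable nonempty family of partial bijections from P to Q satisfying: (i) every element of P lies in dom(f) for some f ∈ F, and every element of Q lies in ran(f) for some f ∈ F; (ii) if f, g ∈ F with dom(f) ∩ dom(g) = ∅ and ran(f) ∩ ran(g) = ∅, then the common extension f ∪ g belongs to F; (iii) for all f, g ∈ F there exists h ∈ F with dom(h) = dom(f) and ran(h) ∩ ran(g) = ∅, and there exists j ∈ F with ran(j) = ran(f) and dom(j) ∩ dom(g) = ∅; (iv) for all f, g ∈ F there exists h ∈ F with dom(h) = dom(f) ∖ dom(g), and there exists j ∈ F with ran(j) = ran(f) ∖ ran(g); (v) if f, g ∈ F and dom(g) ⊆ dom(f), then the restriction of f to dom(g) belongs to F, and if ran(g) ⊆ ran(f), then the restriction of f to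 f⁻¹[ran(g)] belongs to F. Then there exists a bijection i : P → Q such that for every f ∈ F, the restriction of i to dom(f) belongs to F and the restriction of i to i⁻¹[ran(f)] belongs to F. -/
/-- Partial bijections from `P` to `Q` are encoded by their graphs
`f ⊆ P × Q` (functional and injective relations); `dom f = Prod.fst '' f` and
`ran f = Prod.snd '' f`.  Let `P` and `Q` be countably infinite sets and `F` a countable nonempty
family of partial bijections from `P` to `Q` satisfying conditions (i)–(v).  Then there is a
bijection `i : P → Q` such that for every `f ∈ F` the restriction of `i` to `dom f` belongs to
`F` and the restriction of `i` to `i⁻¹[ran f]` belongs to `F`. -/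
theorem exists_bijection_with_internal_finite_restrictions
    (P Q : Type*) [Countable P] [Infinite P] [Countable Q] [Infinite Q]
    (F : Set (Set (P × Q))) (hcount : F.Countable) (hne : F.Nonempty)
    -- each member of `F` is (the graph of) a partial bijection
    (hpb : ∀ f ∈ F, ∀ a ∈ f, ∀ b ∈ f, (a : P × Q).1 = (b : P × Q).1 ↔ a.2 = b.2)
    -- (i) covering of `P` and of `Q`
    (hi₁ : ∀ x : P, ∃ f ∈ F, x ∈ Prod.fst '' f)
    (hi₂ : ∀ y : Q, ∃ f ∈ F, y ∈ Prod.snd '' f)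
    -- (ii) closure under disjoint union
    (hii : ∀ f ∈ F, ∀ g ∈ F, Prod.fst '' f ∩ Prod.fst '' g = ∅ →
      Prod.snd '' f ∩ Prod.snd '' g = ∅ → f ∪ g ∈ F)
    -- (iii) avoiding ranges / domains
    (hiii₁ : ∀ f ∈ F, ∀ g ∈ F, ∃ h ∈ F,
      Prod.fst '' h = Prod.fst '' f ∧ Prod.snd '' h ∩ Prod.snd '' g = ∅)
    (hiii₂ : ∀ f ∈ F, ∀ g ∈ F, ∃ j ∈ F,
      Prod.snd '' j = Prod.snd '' f ∧ Prod.fst '' j ∩ Prod.fst '' g = ∅)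
    -- (iv) domains and ranges realizing set differences
    (hiv₁ : ∀ f ∈ F, ∀ g ∈ F, ∃ h ∈ F, Prod.fst '' h = Prod.fst '' f \ Prod.fst '' g)
    (hiv₂ : ∀ f ∈ F, ∀ g ∈ F, ∃ j ∈ F, Prod.snd '' j = Prod.snd '' f \ Prod.snd '' g)
    -- (v) closure under restrictions
    (hv₁ : ∀ f ∈ F, ∀ g ∈ F, Prod.fst '' g ⊆ Prod.fst '' f →
      {a ∈ f | a.1 ∈ Prod.fst '' g} ∈ F)
    (hv₂ : ∀ f ∈ F, ∀ g ∈ F, Prod.snd '' g ⊆ Prod.snd '' f →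
      {a ∈ f | a.2 ∈ Prod.snd '' g} ∈ F) :
    ∃ i : P → Q, Function.Bijective i ∧
      ∀ f ∈ F, {a : P × Q | a.1 ∈ Prod.fst '' f ∧ a.2 = i a.1} ∈ F ∧
        {a : P × Q | a.2 ∈ Prod.snd '' f ∧ a.2 = i a.1} ∈ F := by
  have hextend : ∀ p f : F, ∃ q : F, p.1 ⊆ q.1 ∧
      Prod.fst '' f.1 ⊆ Prod.fst '' q.1 ∧ Prod.snd '' f.1 ⊆ Prod.snd '' q.1 := by
    rintro ⟨p, hp⟩ ⟨f, hf⟩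
    obtain ⟨g, hg, hgdom⟩ := hiv₁ f hf p hp
    obtain ⟨h, hh, hhdom, hhran⟩ := hiii₁ g hg p hp
    have hq : p ∪ h ∈ F := hii p hp h hh
      (by rw [hhdom, hgdom]; exact Set.inter_sdiff_self _ _) (by rwa [Set.inter_comm])
    obtain ⟨k, hk, hkran⟩ := hiv₂ f hf _ hq
    obtain ⟨j, hj, hjran, hjdom⟩ := hiii₂ k hk _ hq
    refine ⟨⟨(p ∪ h) ∪ j, hii _ hq j hj (by rwa [Set.inter_comm])
      (by rw [hjran, hkran]; exact Set.inter_sdiff_self _ _)⟩,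
      Set.subset_union_left.trans Set.subset_union_left, ?_, ?_⟩
    · simp only [Set.image_union, hhdom, hgdom]
      intro x hx
      by_cases hxp : x ∈ Prod.fst '' p
      · exact Or.inl (Or.inl hxp)
      · exact Or.inl (Or.inr ⟨hx, hxp⟩)
    · rw [Set.image_union _ _ j, hjran, hkran, Set.union_sdiff_self]
      exact Set.subset_union_right
  choose ext hext_le hext_dom hext_ran using hextend
  obtain ⟨e, he⟩ := hcount.exists_eq_range hne
  have heF : ∀ n, e n ∈ F := fun n => he ▸ Set.mem_range_self n
  let s : ℕ → F := fun n => Nat.rec ⟨e 0, heF 0⟩ (fun n p => ext p ⟨e n, heF n⟩) n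
  have hmono : Monotone fun n => (s n).1 := monotone_nat_of_le_succ fun n => hext_le _ _
  have hcover : ∀ f ∈ F, ∃ n, Prod.fst '' f ⊆ Prod.fst '' (s n).1 ∧
      Prod.snd '' f ⊆ Prod.snd '' (s n).1 := by
    intro f hf
    obtain ⟨n, rfl⟩ : f ∈ Set.range e := he ▸ hf
    exact ⟨n + 1, hext_dom (s n) ⟨e n, heF n⟩, hext_ran (s n) ⟨e n, heF n⟩⟩
  have hcompat : ∀ m n, ∀ a ∈ (s m).1, ∀ b ∈ (s n).1, a.1 = b.1 ↔ a.2 = b.2 :=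
    fun m n a ha b hb => hpb _ (s (max m n)).2 a (hmono (le_max_left m n) ha) b
      (hmono (le_max_right m n) hb)
  have htotal : ∀ x, ∃ y n, (x, y) ∈ (s n).1 := by
    intro x
    obtain ⟨f, hf, hx⟩ := hi₁ x
    obtain ⟨n, hn, -⟩ := hcover f hf
    obtain ⟨⟨_, y⟩, hy, rfl⟩ := hn hx
    exact ⟨y, n, hy⟩
  choose i N hi using htotal
  have hgraph : ∀ n, ∀ a ∈ (s n).1, a.2 = i a.1 := fun n a ha =>
    (hcompat n _ a ha _ (hi a.1)).1 rfl
  refine ⟨i, ⟨fun x y hxy => (hcompat _ _ _ (hi x) _ (hi y)).2 hxy, fun y => ?_⟩,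
    fun f hf => ?_⟩
  · obtain ⟨f, hf, hy⟩ := hi₂ y
    obtain ⟨n, -, hn⟩ := hcover f hf
    obtain ⟨a, ha, rfl⟩ := hn hy
    exact ⟨a.1, (hgraph n a ha).symm⟩
  · obtain ⟨n, hdom, hran⟩ := hcover f hf
    constructor
    · convert hv₁ _ (s n).2 f hf hdom using 1
      ext ⟨x, y⟩
      refine ⟨fun ⟨hx, hy⟩ => ⟨?_, hx⟩, fun ⟨hxy, hx⟩ => ⟨hx, hgraph n _ hxy⟩⟩
      obtain ⟨b, hb, hbx⟩ := hdom hx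
      have hby : b = (x, y) := Prod.ext hbx (by rw [hgraph n b hb, hbx]; exact hy.symm)
      exact hby ▸ hb
    · convert hv₂ _ (s n).2 f hf hran using 1
      ext ⟨x, y⟩
      refine ⟨fun ⟨hy, hxy⟩ => ⟨?_, hy⟩, fun ⟨hxy, hy⟩ => ⟨hy, hgraph n _ hxy⟩⟩
      obtain ⟨b, hb, hby⟩ := hran hy
      have hbx : b = (x, y) :=
        Prod.ext ((hcompat n _ b hb _ (hi x)).2 (hby.trans hxy)) hby
      exact hbx ▸ hb
end

section
/- Let P and Q be sets and let F be a countable nonempty family of partial bijections from P to Q satisfying: (ii) if f, g ∈ F with dom(f) ∩ dom(g) = ∅ and ran(f) ∩ ran(g) = ∅, then f ∪ g belongs to F; (iii) for all f, g ∈ F there exists h ∈ F with dom(h) = dom(f) and ran(h) ∩ ran(g) = ∅, and there exists j ∈ F with ran(j) = ran(f) and dom(j) ∩ dom(g) = ∅; (iv) for all f, g ∈ F there exists h ∈ F with dom(h) = dom(f) ∖ dom(g), and there exists j ∈ F with ran(j) = ran(f) ∖ ran(g). Then there exists an increasing chain i₀ ⊆ i₁ ⊆ i₂ ⊆ ⋯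 of members of F such that for every f ∈ F there exists m with dom(f) ⊆ dom(i_m) and ran(f) ⊆ ran(i_m). -/
/-- If members of `F` with disjoint images along `p` and `q` have their union in `F`, images along
`p` are attained while avoiding a given image along `q`, and differences of images along `p` are
attained, then any `g ∈ F` extends to a member of `F` whose image along `p` contains that of a
given `f ∈ F`. -/
theorem exists_superset_image_superset {α β γ : Type*} {F : Set (Set α)} (p : α → β) (q : α → γ)
    (hunion : ∀ f ∈ F, ∀ g ∈ F, p '' f ∩ p '' g = ∅ → q '' f ∩ q '' g = ∅ → f ∪ g ∈ F)
    (havoid : ∀ f ∈ F, ∀ g ∈ F, ∃ h ∈ F, p '' h = p '' f ∧ q '' h ∩ q '' g = ∅)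
    (hdiff : ∀ f ∈ F, ∀ g ∈ F, ∃ h ∈ F, p '' h = p '' f \ p '' g)
    {f g : Set α} (hf : f ∈ F) (hg : g ∈ F) :
    ∃ g' ∈ F, g ⊆ g' ∧ p '' f ⊆ p '' g' := by
  obtain ⟨h, hh, hp⟩ := hdiff f hf g hg
  obtain ⟨k, hk, hkp, hkq⟩ := havoid h hh g hg
  refine ⟨k ∪ g, hunion k hk g hg ?_ hkq, Set.subset_union_right, ?_⟩
  · rw [hkp, hp, Set.sdiff_inter_self]
  · rw [Set.image_union, hkp, hp, Set.sdiff_union_self]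
    exact Set.subset_union_left


/-- Partial bijections from `P` to `Q` are encoded by their graphs
`f ⊆ P × Q` (functional and injective relations), with `dom f = Prod.fst '' f` and
`ran f = Prod.snd '' f`; extension of partial bijections is graph inclusion.  Let `F` be a
countable nonempty family of partial bijections from `P` to `Q` satisfying (ii)–(iv).  Then
there is an increasing chain `i₀ ⊆ i₁ ⊆ ⋯` of members of `F` such that every `f ∈ F` has
`dom f ⊆ dom iₘ` and `ran f ⊆ ran iₘ` for some `m`. -/
theorem exists_increasing_chain_absorbing_domains_and_ranges
    (P Q : Type*) (F : Set (Set (P × Q))) (hcount : F.Countable) (hne : F.Nonempty)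
    -- each member of `F` is (the graph of) a partial bijection
    (hpb : ∀ f ∈ F, ∀ a ∈ f, ∀ b ∈ f, (a : P × Q).1 = (b : P × Q).1 ↔ a.2 = b.2)
    -- (ii) closure under disjoint union
    (hii : ∀ f ∈ F, ∀ g ∈ F, Prod.fst '' f ∩ Prod.fst '' g = ∅ →
      Prod.snd '' f ∩ Prod.snd '' g = ∅ → f ∪ g ∈ F)
    -- (iii) avoiding ranges / domains
    (hiii₁ : ∀ f ∈ F, ∀ g ∈ F, ∃ h ∈ F,
      Prod.fst '' h = Prod.fst '' f ∧ Prod.snd '' h ∩ Prod.snd '' g = ∅)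
    (hiii₂ : ∀ f ∈ F, ∀ g ∈ F, ∃ j ∈ F,
      Prod.snd '' j = Prod.snd '' f ∧ Prod.fst '' j ∩ Prod.fst '' g = ∅)
    -- (iv) domains and ranges realizing set differences
    (hiv₁ : ∀ f ∈ F, ∀ g ∈ F, ∃ h ∈ F, Prod.fst '' h = Prod.fst '' f \ Prod.fst '' g)
    (hiv₂ : ∀ f ∈ F, ∀ g ∈ F, ∃ j ∈ F, Prod.snd '' j = Prod.snd '' f \ Prod.snd '' g) :
    ∃ i : ℕ → Set (P × Q), (∀ m, i m ∈ F) ∧ (∀ m, i m ⊆ i (m + 1)) ∧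
      ∀ f ∈ F, ∃ m, Prod.fst '' f ⊆ Prod.fst '' i m ∧ Prod.snd '' f ⊆ Prod.snd '' i m := by
  have hstep : ∀ f g : F, ∃ g' : F, (g : Set (P × Q)) ⊆ g' ∧
      Prod.fst '' f.1 ⊆ Prod.fst '' g'.1 ∧ Prod.snd '' f.1 ⊆ Prod.snd '' g'.1 := by
    rintro ⟨f, hf⟩ ⟨g, hg⟩
    obtain ⟨g₁, hg₁, hsub₁, hdom⟩ :=
      exists_superset_image_superset Prod.fst Prod.snd hii hiii₁ hiv₁ hf hg
    obtain ⟨g₂, hg₂, hsub₂, hran⟩ :=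
      exists_superset_image_superset Prod.snd Prod.fst
        (fun a ha b hb hr hd => hii a ha b hb hd hr) hiii₂ hiv₂ hf hg₁
    exact ⟨⟨g₂, hg₂⟩, hsub₁.trans hsub₂, hdom.trans (Set.image_mono hsub₂), hran⟩
  choose next hsub hdom hran using hstep
  have : Countable F := hcount.to_subtype
  have : Nonempty F := hne.to_subtype
  obtain ⟨e, he⟩ := exists_surjective_nat F
  let i : ℕ → F := fun n => Nat.rec (e 0) (fun m g => next (e m) g) n
  refine ⟨fun n => (i n).1, fun n => (i n).2, fun n => hsub (e n) (i n), fun f hf => ?_⟩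
  obtain ⟨n, hn⟩ := he ⟨f, hf⟩
  obtain rfl : (e n).1 = f := congrArg Subtype.val hn
  exact ⟨n + 1, hdom (e n) (i n), hran (e n) (i n)⟩
end

section
/- Let L be a first-order language and let M and N be elementarily equivalent L-structures (M and N satisfy exactly the same L-sentences). Then M and N have isomorphic elementary extensions; equivalently, there exist an L-structure C and elementary embeddings of M into C and of N into C. -/
open FirstOrder

universe u v w

namespace FirstOrder.Language

open Formula

variable {L : Language.{u, v}} {M N : Type*} [L.Structure M] [L.Structure N]

theorem Formula.realize_exClosure_iff_exists {α : Type*} [DecidableEq α] [Nonempty M]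
    (φ : L.Formula α) : M ⊨ φ.exClosure ↔ ∃ v : α → M, φ.Realize v := by
  rw [← exists_realize_equivSentence_iff_realize_exClosure]
  refine exists_congr fun v => ?_
  rw [← realize_equivSentence_symm, _root_.Equiv.symm_apply_apply]

theorem ElementarilyEquivalent.exists_realize {α : Type*} [Nonempty M] [Nonempty N]
    (h : M ≅[L] N) {φ : L.Formula α} {v : α → N} (hv : φ.Realize v) :
    ∃ w : α → M, φ.Realize w := by
  classical
  rw [← realize_exClosure_iff_exists, elementarilyEquivalent_iff.1 h,
    realize_exClosure_iff_exists]
  exact ⟨v, hv⟩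

/-- Elementarily equivalent structures with empty domains: the empty map is elementary. -/
def ElementarilyEquivalent.elementaryEmbeddingOfIsEmpty [IsEmpty M] (h : M ≅[L] N) :
    M ↪ₑ[L] N where
  toFun := isEmptyElim
  map_formula' n φ x := by
    obtain _ | n := n
    · have key := elementarilyEquivalent_iff.1 h (φ.relabel Fin.elim0)
      simp only [Sentence.Realize, realize_relabel] at key
      convert key.symm using 2
    · exact isEmptyElim (x 0)

/-- The theory, with constants from `α`, of all formulas satisfied by the tuple `v`. -/
def tupleTheory {α β : Type*} (L : Language.{u, v}) [L.Structure M] (i : α → β) (v : α → M) :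
    L[[β]].Theory :=
  (fun φ : L.Formula α => equivSentence (φ.relabel i)) '' {φ | φ.Realize v}

/-- A model of the theory of all formulas true in `M`, with constants naming the elements
of `M`, is an elementary extension of `M`. -/
def ElementaryEmbedding.ofModelsTupleTheory {β : Type*} {C : Type*} [L.Structure C]
    [L[[β]].Structure C] [(L.lhomWithConstants β).IsExpansionOn C] (i : M → β)
    (hC : C ⊨ tupleTheory L i (id : M → M)) : M ↪ₑ[L] C where
  toFun m := (L.con (i m) : C)
  map_formula' n φ x := by
    have key (ψ : L.Formula (Fin n)) (hψ : ψ.Realize x) :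
        ψ.Realize fun k => (L.con (i (x k)) : C) := by
      have := hC.realize_of_mem _ ⟨ψ.relabel x, realize_relabel.2 hψ, rfl⟩
      simpa [realize_equivSentence, realize_relabel, Function.comp_def] using this
    refine ⟨fun hφ => ?_, key φ⟩
    by_contra hn
    exact realize_not.1 (key φ.not (realize_not.2 hn)) hφ

theorem ElementarilyEquivalent.isSatisfiable_tupleTheory_union [Nonempty M] [Nonempty N]
    (h : M ≅[L] N) :
    (tupleTheory L (Sum.inl : M → M ⊕ N) (id : M → M) ∪
      tupleTheory L (Sum.inr : N → M ⊕ N) (id : N → N)).IsSatisfiable := by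
  rw [Theory.isSatisfiable_iff_isFinitelySatisfiable]
  intro T₀ hT₀
  have hex (σ : T₀) : ∃ φ : L.Formula N, φ.Realize id ∧
      (σ.1 ∈ tupleTheory L (Sum.inr : N → M ⊕ N) (id : N → N) →
        equivSentence (φ.relabel Sum.inr) = σ.1) := by
    by_cases hσ : σ.1 ∈ tupleTheory L (Sum.inr : N → M ⊕ N) (id : N → N)
    · obtain ⟨φ, hφ, hφσ⟩ := hσ
      exact ⟨φ, hφ, fun _ => hφσ⟩
    · exact ⟨⊤, realize_top.2 trivial, fun h => absurd h hσ⟩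
  choose g hg hgσ using hex
  obtain ⟨a, ha⟩ := h.exists_realize (φ := Formula.iInf g) (v := id) (by
    simpa [Formula.iInf, Formula.Realize, BoundedFormula.realize_iInf] using hg)
  replace ha : ∀ σ, (g σ).Realize a := by
    simpa only [Formula.iInf, Formula.Realize, BoundedFormula.realize_iInf] using ha
  let := constantsOn.structure (Sum.elim id a : M ⊕ N → M)
  have : M ⊨ (T₀ : L[[M ⊕ N]].Theory) := by
    refine ⟨fun σ hσ => ?_⟩
    rcases hT₀ hσ with ⟨φ, hφ, rfl⟩ | hN
    · rw [realize_equivSentence, realize_relabel]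
      exact hφ
    · have hσg := hgσ ⟨σ, hσ⟩ hN
      dsimp only at hσg
      rw [← hσg, realize_equivSentence, realize_relabel]
      exact ha ⟨σ, hσ⟩
  exact Theory.Model.isSatisfiable M

end FirstOrder.Language

/-- Elementarily equivalent `L`-structures `M` and `N` have isomorphic
elementary extensions; equivalently, there exist an `L`-structure `C` and elementary embeddings
of `M` into `C` and of `N` into `C`. -/
theorem elementarilyEquivalent_implies_joint_elementary_extension
    (L : FirstOrder.Language.{u, v}) (M N : Type w) [L.Structure M] [L.Structure N]
    (h : M ≅[L] N) :
    ∃ (C : Type (max u v w)) (_ : L.Structure C),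
      Nonempty (M ↪ₑ[L] C) ∧ Nonempty (N ↪ₑ[L] C) := by
  rcases isEmpty_or_nonempty M with hM | hM
  · have hN : IsEmpty N := by
      rwa [← not_nonempty_iff, ← h.nonempty_iff, not_nonempty_iff]
    let e : M ≃ ULift.{max u v} M := Equiv.ulift.symm
    let : L.Structure (ULift.{max u v} M) := e.inducedStructure
    let f : M ↪ₑ[L] ULift.{max u v} M := e.inducedStructureEquiv.toElementaryEmbedding
    exact ⟨ULift.{max u v} M, inferInstance, ⟨f⟩,
      ⟨(h.symm.trans f.elementarilyEquivalent).elementaryEmbeddingOfIsEmpty⟩⟩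
  · have hN : Nonempty N := h.nonempty_iff.1 hM
    obtain ⟨C⟩ := h.isSatisfiable_tupleTheory_union
    let := (L.lhomWithConstants (M ⊕ N)).reduct C
    have hC := FirstOrder.Language.Theory.model_union_iff.1 C.is_model
    exact ⟨C, inferInstance, ⟨.ofModelsTupleTheory Sum.inl hC.1⟩,
      ⟨.ofModelsTupleTheory Sum.inr hC.2⟩⟩
end
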